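/- Let d ≥ 2 be an integer, s ∈ (0, d/2), α ∈ (0,1) with s + α > 1. For λ > 0 define I_mix(λ) := λ ∫_{ℝ^d} ⟨k⟩^{−d−2α} |λ e₁ − k|^{−2s} (k₁ k₂² / |k|²) dk, where e₁, e₂ are the first two standard basis vectors of ℝ^d, k₁ = k·e₁, k₂ = k·e₂. Then there exist constants R ≥ 1 and ρ ≥ 0 such that for all λ ≥ R, |I_mix(λ) − 2α(s+α−1)·C_{d,s,α}·λ^{−2s+2−2α}| ≤ ρ λ^{−2s}. -/

import Mathlib

open MeasureTheory

noncomputable section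

/-- The Japanese bracket `⟨x⟩ = (1+|x|²)^{1/2}`. -/
def jap {d : ℕ} (x : EuclideanSpace ℝ (Fin d)) : ℝ := Real.sqrt (1 + ‖x‖^2)

/-- The constant `C_{d,s,α}`. -/
def Cconst (d : ℕ) (s α : ℝ) : ℝ :=
  -(Real.pi ^ ((d : ℝ)/2) * Real.Gamma (s + α - 1) * Real.Gamma (((d : ℝ) - 2*s + 2)/2)
      * Real.Gamma (-α)) /
    (4 * Real.Gamma s * Real.Gamma (((d : ℝ) + 2 + 2*α)/2)
      * Real.Gamma (((d : ℝ) + 4 - 2*s - 2*α)/2))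

lemma integral_mul_exp_neg_mul_sq_eq_zero (b : ℝ) :
    ∫ x : ℝ, x * Real.exp (-b * x ^ 2) = 0 := by
  have h := integral_neg_eq_self (fun x : ℝ => x * Real.exp (-b * x ^ 2)) volume
  simp only [even_two, Even.neg_pow, neg_mul, integral_neg] at h ⊢
  linarith

lemma integral_sq_mul_exp_neg_mul_sq {b : ℝ} (hb : 0 < b) :
    ∫ x : ℝ, x ^ 2 * Real.exp (-b * x ^ 2) = (1 / (2 * b)) * √(Real.pi / b) := by
  have h2 : Integrable (fun x : ℝ => x ^ 2 * Real.exp (-b * x ^ 2)) := by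
    simpa using integrable_rpow_mul_exp_neg_mul_sq hb (s := 2) (by norm_num)
  have h0 := integrable_exp_neg_mul_sq hb
  have hderiv : ∀ x : ℝ, HasDerivAt (fun x => x * Real.exp (-b * x ^ 2))
      (Real.exp (-b * x ^ 2) - 2 * b * (x ^ 2 * Real.exp (-b * x ^ 2))) x := by
    intro x
    have h := (hasDerivAt_id x).mul (((hasDerivAt_pow 2 x).const_mul (-b)).exp)
    refine h.congr_deriv ?_
    simp
    ring
  have h := integral_eq_zero_of_hasDerivAt_of_integrable hderiv (h0.sub (h2.const_mul (2 * b)))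
    (integrable_mul_exp_neg_mul_sq hb)
  rw [integral_sub h0 (h2.const_mul (2 * b)), integral_const_mul, integral_gaussian] at h
  rw [div_mul_eq_mul_div, eq_div_iff (by positivity)]
  linarith

lemma integral_mul_exp_two_gaussians {t τ : ℝ} (ht : 0 < t) (hτ : 0 < τ) (l : ℝ) :
    ∫ x : ℝ, x * Real.exp (-τ * x ^ 2 - t * (l - x) ^ 2)
      = (l * (t / (t + τ)) * Real.exp (-(l ^ 2 * (t * τ / (t + τ))))) * √(Real.pi / (t + τ)) := by
  have hb : 0 < t + τ := by positivity
  rw [← integral_add_right_eq_self _ (l * (t / (t + τ)))]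
  have : ∀ x : ℝ, (x + l * (t / (t + τ))) *
        Real.exp (-τ * (x + l * (t / (t + τ))) ^ 2 - t * (l - (x + l * (t / (t + τ)))) ^ 2)
      = Real.exp (-(l ^ 2 * (t * τ / (t + τ)))) * (x * Real.exp (-(t + τ) * x ^ 2))
        + (l * (t / (t + τ)) * Real.exp (-(l ^ 2 * (t * τ / (t + τ))))) *
          Real.exp (-(t + τ) * x ^ 2) := by
    intro x
    have e : -τ * (x + l * (t / (t + τ))) ^ 2 - t * (l - (x + l * (t / (t + τ)))) ^ 2
        = -(l ^ 2 * (t * τ / (t + τ))) + -(t + τ) * x ^ 2 := by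
      field_simp
      ring
    rw [e, Real.exp_add]
    ring
  simp_rw [this]
  rw [integral_add ((integrable_mul_exp_neg_mul_sq hb).const_mul _)
    ((integrable_exp_neg_mul_sq hb).const_mul _), integral_const_mul, integral_const_mul,
    integral_mul_exp_neg_mul_sq_eq_zero, integral_gaussian]
  ring

/-- The Gaussian integral produced by subordinating both factors of the mixed integrand. -/
lemma integral_mixed_gaussian {d : ℕ} {i j : Fin d} (hij : i ≠ j) {t τ : ℝ} (ht : 0 < t)
    (hτ : 0 < τ) (l : ℝ) :
    ∫ k : EuclideanSpace ℝ (Fin d), (k i * k j ^ 2) *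
        Real.exp (-τ * ‖k‖ ^ 2 - t * ‖l • EuclideanSpace.single i (1 : ℝ) - k‖ ^ 2)
      = l * (Real.pi ^ ((d : ℝ) / 2) / 2) * (t * (t + τ) ^ (-((d : ℝ) / 2) - 2)
          * Real.exp (-(l ^ 2 * (t * τ / (t + τ))))) := by
  have hb : 0 < t + τ := by positivity
  have hmp := EuclideanSpace.volume_preserving_symm_measurableEquiv_toLp (Fin d)
  let g : Fin d → ℝ → ℝ := fun m x =>
    (if m = i then x else 1) * (if m = j then x ^ 2 else 1) *
      Real.exp (-τ * x ^ 2 - t * ((if m = i then l else 0) - x) ^ 2)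
  have hpt : ∀ k : EuclideanSpace ℝ (Fin d), (k i * k j ^ 2) *
        Real.exp (-τ * ‖k‖ ^ 2 - t * ‖l • EuclideanSpace.single i (1 : ℝ) - k‖ ^ 2)
      = ∏ m, g m ((MeasurableEquiv.toLp 2 (Fin d → ℝ)).symm k m) := by
    intro k
    simp only [g, Finset.prod_mul_distrib, ← Real.exp_sum, Finset.prod_ite_eq', Finset.mem_univ,
      if_true]
    congr 2
    rw [EuclideanSpace.norm_sq_eq, EuclideanSpace.norm_sq_eq, Finset.mul_sum, Finset.mul_sum,
      ← Finset.sum_sub_distrib]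
    refine Finset.sum_congr rfl fun m _ => ?_
    simp
  have hcomp : ∀ m, ∫ x, g m x = (if m = i then
        l * (t / (t + τ)) * Real.exp (-(l ^ 2 * (t * τ / (t + τ)))) else 1) *
      (if m = j then 1 / (2 * (t + τ)) else 1) * √(Real.pi / (t + τ)) := by
    intro m
    by_cases hi : m = i
    · have hj : m ≠ j := hi ▸ hij
      simp only [g, if_pos hi, if_neg hj, mul_one]
      exact integral_mul_exp_two_gaussians ht hτ l
    · have e : ∀ x : ℝ, -τ * x ^ 2 - t * (0 - x) ^ 2 = -(t + τ) * x ^ 2 := fun x => by ring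
      by_cases hj : m = j
      · simp only [g, if_neg hi, if_pos hj, one_mul, e]
        exact integral_sq_mul_exp_neg_mul_sq hb
      · simp only [g, if_neg hi, if_neg hj, one_mul, e]
        exact integral_gaussian _
  simp_rw [hpt]
  rw [hmp.integral_comp' (g := fun x : Fin d → ℝ => ∏ m, g m (x m)),
    integral_fintype_prod_volume_eq_prod]
  simp only [hcomp, Finset.prod_mul_distrib, Finset.prod_ite_eq', Finset.mem_univ, if_true,
    Finset.prod_const, Finset.card_univ, Fintype.card_fin]
  have hs : √(Real.pi / (t + τ)) ^ d = Real.pi ^ ((d : ℝ) / 2) * (t + τ) ^ (-((d : ℝ) / 2)) := by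
    rw [Real.sqrt_eq_rpow, ← Real.rpow_natCast, ← Real.rpow_mul (by positivity),
      Real.div_rpow Real.pi_pos.le hb.le, Real.rpow_neg hb.le, div_eq_mul_inv]
    congr 2 <;> ring_nf
  rw [hs, Real.rpow_sub hb, Real.rpow_two]
  field_simp

lemma integrableOn_rpow_mul_exp_neg_mul_Ioi {a r : ℝ} (ha : 0 < a) (hr : 0 < r) :
    IntegrableOn (fun t : ℝ => t ^ (a - 1) * Real.exp (-(r * t))) (Set.Ioi 0) := by
  apply Integrable.of_integral_ne_zero
  rw [Real.integral_rpow_mul_exp_neg_mul_Ioi ha hr]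
  have := Real.Gamma_pos_of_pos ha
  positivity

/-- The lower incomplete Gamma function. -/
def lowerGamma (β τ : ℝ) : ℝ := ∫ v in (0 : ℝ)..τ, v ^ (β - 1) * Real.exp (-v)

lemma intervalIntegrable_rpow_mul_exp_neg {β : ℝ} (hβ : 0 < β) (a b : ℝ) :
    IntervalIntegrable (fun v : ℝ => v ^ (β - 1) * Real.exp (-v)) volume a b :=
  (intervalIntegral.intervalIntegrable_rpow' (by linarith)).mul_continuousOn
    (by fun_prop)

lemma continuous_lowerGamma {β : ℝ} (hβ : 0 < β) : Continuous (lowerGamma β) :=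
  intervalIntegral.continuous_primitive (intervalIntegrable_rpow_mul_exp_neg hβ) 0

lemma hasDerivAt_lowerGamma {β : ℝ} (hβ : 0 < β) {τ : ℝ} (hτ : 0 < τ) :
    HasDerivAt (lowerGamma β) (τ ^ (β - 1) * Real.exp (-τ)) τ := by
  refine intervalIntegral.integral_hasDerivAt_right (intervalIntegrable_rpow_mul_exp_neg hβ 0 τ)
    (Measurable.stronglyMeasurable (by fun_prop)).stronglyMeasurableAtFilter ?_
  exact (Real.continuousAt_rpow_const _ _ (Or.inl hτ.ne')).mul (by fun_prop)

lemma lowerGamma_nonneg (β : ℝ) {τ : ℝ} (hτ : 0 ≤ τ) : 0 ≤ lowerGamma β τ :=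
  intervalIntegral.integral_nonneg hτ fun _ hv =>
    mul_nonneg (Real.rpow_nonneg hv.1 _) (Real.exp_pos _).le

lemma integral_zero_rpow_sub_one {β : ℝ} (hβ : 0 < β) (τ : ℝ) :
    ∫ v in (0 : ℝ)..τ, v ^ (β - 1) = τ ^ β / β := by
  rw [integral_rpow (Or.inl (by linarith)), sub_add_cancel, Real.zero_rpow hβ.ne', sub_zero]

lemma lowerGamma_le {β : ℝ} (hβ : 0 < β) {τ : ℝ} (hτ : 0 ≤ τ) :
    lowerGamma β τ ≤ τ ^ β / β := by
  rw [← integral_zero_rpow_sub_one hβ]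
  refine intervalIntegral.integral_mono_on hτ (intervalIntegrable_rpow_mul_exp_neg hβ 0 τ)
    (intervalIntegral.intervalIntegrable_rpow' (by linarith)) fun v hv => ?_
  exact mul_le_of_le_one_right (Real.rpow_nonneg hv.1 _) (Real.exp_le_one_iff.2 (by linarith [hv.1]))

lemma rpow_div_sub_lowerGamma_le {β : ℝ} (hβ : 0 < β) {τ : ℝ} (hτ : 0 ≤ τ) :
    τ ^ β / β - lowerGamma β τ ≤ τ ^ (β + 1) / (β + 1) := by
  have h1 : IntervalIntegrable (fun v : ℝ => v ^ (β - 1)) volume 0 τ :=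
    intervalIntegral.intervalIntegrable_rpow' (by linarith)
  have h2 := intervalIntegrable_rpow_mul_exp_neg hβ 0 τ
  rw [← integral_zero_rpow_sub_one hβ, ← integral_zero_rpow_sub_one (by linarith : 0 < β + 1),
    lowerGamma, ← intervalIntegral.integral_sub h1 h2]
  refine intervalIntegral.integral_mono_on_of_le_Ioo hτ (h1.sub h2)
    (intervalIntegral.intervalIntegrable_rpow' (by linarith)) fun v hv => ?_
  rw [add_sub_right_comm, Real.rpow_add_one hv.1.ne', ← mul_one_sub]
  have := Real.add_one_le_exp (-v)
  have := Real.rpow_nonneg hv.1.le (β - 1)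
  gcongr
  linarith

lemma integrableOn_lowerGamma_mul_exp {β r : ℝ} (hβ : 0 < β) (hr : 0 < r) :
    IntegrableOn (fun τ => lowerGamma β τ * Real.exp (-(r * τ))) (Set.Ioi 0) := by
  refine ((integrableOn_rpow_mul_exp_neg_mul_Ioi (by linarith : 0 < β + 1) hr).div_const β).mono'
    ((continuous_lowerGamma hβ).mul (by fun_prop)).aestronglyMeasurable ?_
  refine (ae_restrict_iff' measurableSet_Ioi).2 (.of_forall fun τ hτ => ?_)
  have hτ : 0 < τ := hτ
  rw [Real.norm_of_nonneg (mul_nonneg (lowerGamma_nonneg β hτ.le) (Real.exp_pos _).le),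
    add_sub_cancel_right, mul_div_right_comm]
  gcongr
  exact lowerGamma_le hβ hτ.le

/-- The Laplace transform of the lower incomplete Gamma function. -/
lemma integral_lowerGamma_mul_exp {β r : ℝ} (hβ : 0 < β) (hr : 0 < r) :
    ∫ τ in Set.Ioi 0, lowerGamma β τ * Real.exp (-(r * τ))
      = Real.Gamma β * (1 + r) ^ (-β) / r := by
  have hr1 : 0 < 1 + r := by linarith
  have hprod : ∀ τ : ℝ, τ ^ (β - 1) * Real.exp (-τ) * (-Real.exp (-(r * τ)) / r)
      = -(τ ^ (β - 1) * Real.exp (-((1 + r) * τ)) / r) := by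
    intro τ
    rw [show -((1 + r) * τ) = -τ + -(r * τ) by ring, Real.exp_add]
    ring
  have hcont : Continuous fun τ => lowerGamma β τ * (-Real.exp (-(r * τ)) / r) :=
    (continuous_lowerGamma hβ).mul (by fun_prop)
  have h := integral_Ioi_mul_deriv_eq_deriv_mul (a := 0) (a' := 0) (b' := 0)
    (u := lowerGamma β) (v := fun τ => -Real.exp (-(r * τ)) / r)
    (u' := fun τ => τ ^ (β - 1) * Real.exp (-τ)) (v' := fun τ => Real.exp (-(r * τ)))
    (fun τ hτ => hasDerivAt_lowerGamma hβ hτ) ?_ (integrableOn_lowerGamma_mul_exp hβ hr) ?_ ?_ ?_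
  · rw [h]
    simp_rw [hprod]
    rw [integral_neg, integral_div, Real.integral_rpow_mul_exp_neg_mul_Ioi hβ hr1, one_div,
      Real.inv_rpow hr1.le, Real.rpow_neg hr1.le]
    ring
  · intro τ _
    have h := (((hasDerivAt_id τ).const_mul r).neg.exp.neg).div_const r
    refine h.congr_deriv ?_
    simp
    field_simp
  · refine IntegrableOn.congr_fun
      (((integrableOn_rpow_mul_exp_neg_mul_Ioi hβ hr1).div_const r).neg) (fun τ _ => ?_)
      measurableSet_Ioi
    exact (hprod τ).symm
  · have h0 := hcont.tendsto 0
    simp only [lowerGamma, intervalIntegral.integral_same, zero_mul] at h0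
    exact h0.mono_left nhdsWithin_le_nhds
  · have h0 := ((tendsto_rpow_mul_exp_neg_mul_atTop_nhds_zero β r hr).div_const (β * r))
    rw [zero_div] at h0
    refine squeeze_zero_norm' ?_ h0
    filter_upwards [Filter.eventually_gt_atTop 0] with τ hτ
    simp only [Pi.mul_apply, norm_mul, norm_div, norm_neg, Real.norm_of_nonneg
      (lowerGamma_nonneg β hτ.le), Real.norm_of_nonneg (Real.exp_pos _).le,
      Real.norm_of_nonneg hr.le]
    calc lowerGamma β τ * (Real.exp (-(r * τ)) / r)
        ≤ τ ^ β / β * (Real.exp (-(r * τ)) / r) := by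
          gcongr
          exact lowerGamma_le hβ hτ.le
      _ = _ := by rw [neg_mul]; field_simp

/-- The error made by replacing `lowerGamma β` by its leading power is integrable against
`τ ^ (-γ)`. -/
lemma integrableOn_rpow_div_sub_lowerGamma {β γ : ℝ} (hβ : 0 < β) (h1 : β + 1 < γ)
    (h2 : γ < β + 2) :
    IntegrableOn (fun τ => (τ ^ β / β - lowerGamma β τ) * τ ^ (-γ)) (Set.Ioi 0) := by
  have hm : Measurable fun τ => (τ ^ β / β - lowerGamma β τ) * τ ^ (-γ) := by
    have := (continuous_lowerGamma hβ).measurable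
    fun_prop
  have hn : ∀ τ : ℝ, 0 < τ → ‖(τ ^ β / β - lowerGamma β τ) * τ ^ (-γ)‖
      = (τ ^ β / β - lowerGamma β τ) * τ ^ (-γ) := fun τ hτ =>
    Real.norm_of_nonneg (mul_nonneg (sub_nonneg.2 (lowerGamma_le hβ hτ.le))
      (Real.rpow_nonneg hτ.le _))
  rw [← Set.Ioc_union_Ioi_eq_Ioi zero_le_one]
  refine IntegrableOn.union ?_ ?_
  · have hI : IntegrableOn (fun τ : ℝ => τ ^ (β + 1 - γ) / (β + 1)) (Set.Ioc 0 1) :=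
      ((intervalIntegrable_iff_integrableOn_Ioc_of_le zero_le_one).1
        (intervalIntegral.intervalIntegrable_rpow' (by linarith))).div_const _
    refine hI.mono' hm.aestronglyMeasurable
      ((ae_restrict_iff' measurableSet_Ioc).2 (.of_forall fun τ hτ => ?_))
    rw [hn τ hτ.1, sub_eq_add_neg (β + 1), Real.rpow_add hτ.1, mul_div_right_comm]
    have := Real.rpow_nonneg hτ.1.le (-γ)
    gcongr
    exact rpow_div_sub_lowerGamma_le hβ hτ.1.le
  · have hI : IntegrableOn (fun τ : ℝ => τ ^ (β - γ) / β) (Set.Ioi 1) :=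
      (integrableOn_Ioi_rpow_of_lt (by linarith) one_pos).div_const _
    refine hI.mono' hm.aestronglyMeasurable
      ((ae_restrict_iff' measurableSet_Ioi).2 (.of_forall fun τ hτ => ?_))
    have hτ : 0 < τ := zero_lt_one.trans hτ
    rw [hn τ hτ, sub_eq_add_neg β, Real.rpow_add hτ, mul_div_right_comm]
    have := Real.rpow_nonneg hτ.le (-γ)
    gcongr
    linarith [lowerGamma_nonneg β hτ.le]

lemma integral_rpow_mul_one_add_rpow {a b : ℝ} (ha : 0 < a) (hb : 0 < b) :
    ∫ v in Set.Ioi (0 : ℝ), v ^ (a - 1) * (1 + v) ^ (-(a + b))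
      = Real.Gamma a * Real.Gamma b / Real.Gamma (a + b) := by
  have hab : 0 < a + b := by positivity
  have hG := Real.Gamma_pos_of_pos hab
  let f : ℝ → ℝ → ℝ := fun v x => v ^ (a - 1) * (x ^ (a + b - 1) * Real.exp (-((1 + v) * x)))
  have hsplit : ∀ v x : ℝ, f v x
      = x ^ (a + b - 1) * Real.exp (-x) * (v ^ (a - 1) * Real.exp (-(x * v))) := by
    intro v x
    simp only [f]
    rw [show -((1 + v) * x) = -x + -(x * v) by ring, Real.exp_add]
    ring
  have hinner : ∀ x ∈ Set.Ioi (0 : ℝ), ∫ v in Set.Ioi (0 : ℝ), f v x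
      = Real.Gamma a * (x ^ (b - 1) * Real.exp (-(1 * x))) := by
    intro x hx
    have hx : 0 < x := hx
    simp_rw [hsplit]
    rw [integral_const_mul, Real.integral_rpow_mul_exp_neg_mul_Ioi ha hx, one_div,
      Real.inv_rpow hx.le, show a + b - 1 = a + (b - 1) by ring, Real.rpow_add hx, one_mul]
    have := Real.rpow_pos_of_pos hx a
    field_simp
  have hfint : Integrable (Function.uncurry f)
      ((volume.restrict (Set.Ioi 0)).prod (volume.restrict (Set.Ioi 0))) := by
    rw [integrable_prod_iff' (Measurable.aestronglyMeasurable (by unfold Function.uncurry; fun_prop))]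
    refine ⟨(ae_restrict_iff' measurableSet_Ioi).2 (.of_forall fun x hx => ?_), ?_⟩
    · simp only [Function.uncurry, hsplit]
      exact (integrableOn_rpow_mul_exp_neg_mul_Ioi ha hx).const_mul _
    · refine IntegrableOn.congr_fun ((integrableOn_rpow_mul_exp_neg_mul_Ioi hb one_pos).const_mul
        (Real.Gamma a)) (fun x hx => ?_) measurableSet_Ioi
      rw [← hinner x hx]
      refine setIntegral_congr_fun measurableSet_Ioi fun v hv => ?_
      have hv : 0 < v := hv
      have hx : 0 < x := hx
      exact (Real.norm_of_nonneg (by simp only [f]; positivity)).symm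
  have hswap := integral_integral_swap hfint
  rw [setIntegral_congr_fun measurableSet_Ioi hinner, integral_const_mul,
    Real.integral_rpow_mul_exp_neg_mul_Ioi hb one_pos, div_one, Real.one_rpow, one_mul] at hswap
  rw [← hswap, eq_div_iff hG.ne', ← integral_mul_const]
  refine setIntegral_congr_fun measurableSet_Ioi fun v hv => ?_
  have hv : 0 < v := hv
  have hv1 : 0 < 1 + v := by linarith
  simp only [f]
  rw [integral_const_mul, Real.integral_rpow_mul_exp_neg_mul_Ioi hab hv1, one_div,
    Real.inv_rpow hv1.le, Real.rpow_neg hv1.le, mul_assoc]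

lemma integrableOn_rpow_mul_one_add_rpow {a b : ℝ} (ha : 0 < a) (hb : 0 < b) :
    IntegrableOn (fun v : ℝ => v ^ (a - 1) * (1 + v) ^ (-(a + b))) (Set.Ioi 0) := by
  apply Integrable.of_integral_ne_zero
  rw [integral_rpow_mul_one_add_rpow ha hb]
  have := Real.Gamma_pos_of_pos ha
  have := Real.Gamma_pos_of_pos hb
  have := Real.Gamma_pos_of_pos (add_pos ha hb)
  positivity

/-- The angular part of the mixed integral after subordination. -/
def mixKernel (s D x : ℝ) : ℝ :=
  ∫ v in Set.Ioi (0 : ℝ), v ^ s * (1 + v) ^ (-D - 2) * Real.exp (-(x * (v / (1 + v))))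

lemma mixKernel_nonneg (s D x : ℝ) : 0 ≤ mixKernel s D x := by
  refine setIntegral_nonneg measurableSet_Ioi fun v hv => ?_
  have hv : 0 < v := hv
  positivity

lemma rpow_le_rpow_self_mul_exp {y p : ℝ} (hy : 0 < y) (hp : 0 < p) :
    y ^ p ≤ p ^ p * Real.exp y := by
  have h : y ≤ p * Real.exp (y / p) := by
    have := Real.add_one_le_exp (y / p)
    calc y = p * (y / p) := by field_simp
      _ ≤ _ := by gcongr; linarith
  calc y ^ p ≤ (p * Real.exp (y / p)) ^ p := by gcongr
    _ = p ^ p * Real.exp y := by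
      rw [Real.mul_rpow hp.le (Real.exp_pos _).le, ← Real.exp_mul, div_mul_cancel₀ _ hp.ne']

lemma exists_mixKernel_le {s D : ℝ} (hs : 0 < s) (hsD : s < D) :
    ∃ C : ℝ, 0 ≤ C ∧ ∀ x : ℝ, 0 < x → mixKernel s D x ≤ C * x ^ (-s - 1) := by
  have hs1 : 0 < s + 1 := by linarith
  have hI : IntegrableOn (fun v : ℝ => v ^ s * (1 + v) ^ (-D - 2)) (Set.Ioi 0) := by
    have := integrableOn_rpow_mul_one_add_rpow hs1 (by linarith : 0 < D + 1 - s)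
    ring_nf at this ⊢
    exact this
  set B := ∫ v in Set.Ioi (0 : ℝ), v ^ s * (1 + v) ^ (-D - 2) with hB
  have hB0 : 0 ≤ B := setIntegral_nonneg measurableSet_Ioi fun v hv => by
    have hv : 0 < v := hv
    positivity
  have hG := Real.Gamma_pos_of_pos hs1
  refine ⟨2 ^ (s + 1) * Real.Gamma (s + 1) + B * ((s + 1) ^ (s + 1) * 2 ^ (s + 1)), by positivity,
    fun x hx => ?_⟩
  have hx2 : 0 < x / 2 := by positivity
  have hE := integrableOn_rpow_mul_exp_neg_mul_Ioi hs1 hx2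
  have hEv := Real.integral_rpow_mul_exp_neg_mul_Ioi hs1 hx2
  rw [add_sub_cancel_right] at hE hEv
  have hle : mixKernel s D x ≤ ∫ v in Set.Ioi (0 : ℝ), (v ^ s * Real.exp (-(x / 2 * v)) +
      v ^ s * (1 + v) ^ (-D - 2) * Real.exp (-(x / 2))) := by
    refine integral_mono_of_nonneg ?_ (hE.add (hI.mul_const _)) ?_
    · refine (ae_restrict_iff' measurableSet_Ioi).2 (.of_forall fun v hv => ?_)
      have hv : 0 < v := hv
      show 0 ≤ _
      positivity
    · refine (ae_restrict_iff' measurableSet_Ioi).2 (.of_forall fun v hv => ?_)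
      have hv : 0 < v := hv
      have hvs := Real.rpow_pos_of_pos hv s
      have h1v : 0 < (1 + v) ^ (-D - 2) := by positivity
      show v ^ s * (1 + v) ^ (-D - 2) * Real.exp (-(x * (v / (1 + v)))) ≤ _
      rcases le_total v 1 with h | h
      · have h3 : v / 2 ≤ v / (1 + v) := div_le_div_of_nonneg_left hv.le (by linarith) (by linarith)
        have h4 : x / 2 * v ≤ x * (v / (1 + v)) := by
          linarith [mul_le_mul_of_nonneg_left h3 hx.le]
        have h1 : (1 + v) ^ (-D - 2) ≤ 1 :=
          Real.rpow_le_one_of_one_le_of_nonpos (by linarith) (by linarith)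
        calc _ ≤ v ^ s * 1 * Real.exp (-(x / 2 * v)) :=
              mul_le_mul (mul_le_mul_of_nonneg_left h1 hvs.le) (Real.exp_le_exp.2 (by linarith))
                (Real.exp_pos _).le (by positivity)
          _ ≤ _ := by rw [mul_one]; exact le_add_of_nonneg_right (by positivity)
      · have h3 : 1 / 2 ≤ v / (1 + v) := by
          rw [div_le_div_iff₀ two_pos (by linarith)]
          linarith
        calc _ ≤ v ^ s * (1 + v) ^ (-D - 2) * Real.exp (-(x / 2)) := by
              gcongr
              nlinarith
          _ ≤ _ := le_add_of_nonneg_left (by positivity)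
  refine hle.trans ?_
  rw [integral_add hE (hI.mul_const _), integral_mul_const, hEv, ← hB]
  have hxs := Real.rpow_pos_of_pos hx (s + 1)
  have h2s := Real.rpow_pos_of_pos two_pos (s + 1)
  have hexp : Real.exp (-(x / 2)) ≤ (s + 1) ^ (s + 1) * 2 ^ (s + 1) * x ^ (-s - 1) := by
    have h := rpow_le_rpow_self_mul_exp hx2 hs1
    rw [Real.div_rpow hx.le two_pos.le, div_le_iff₀ h2s] at h
    rw [Real.exp_neg, show -s - 1 = -(s + 1) by ring, Real.rpow_neg hx.le, ← div_eq_mul_inv,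
      le_div_iff₀ hxs, inv_mul_le_iff₀ (Real.exp_pos _)]
    linarith
  have h1 : (1 / (x / 2)) ^ (s + 1) = 2 ^ (s + 1) * x ^ (-s - 1) := by
    rw [one_div_div, Real.div_rpow two_pos.le hx.le, show -s - 1 = -(s + 1) by ring,
      Real.rpow_neg hx.le, div_eq_mul_inv]
  rw [h1]
  nlinarith [mul_le_mul_of_nonneg_left hexp hB0]

/-- The Mellin transform of `mixKernel`. -/
lemma integral_rpow_mul_mixKernel {s D α L : ℝ} (hs : 0 < s) (hsD : s < D) (hα0 : 0 < α)
    (hα1 : α < 1) (hL : 0 < L) :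
    ∫ τ in Set.Ioi (0 : ℝ), τ ^ (s + α - 1) * mixKernel s D (L * τ)
      = L ^ (-(s + α)) * Real.Gamma (s + α) *
        (Real.Gamma (1 - α) * Real.Gamma (D + 1 - s) / Real.Gamma (D + 2 - s - α)) := by
  have hp : 0 < s + α := by positivity
  have ha : 0 < 1 - α := by linarith
  have hb : 0 < D + 1 - s := by linarith
  let f : ℝ → ℝ → ℝ := fun v τ => v ^ s * (1 + v) ^ (-D - 2) *
    (τ ^ (s + α - 1) * Real.exp (-((L * (v / (1 + v))) * τ)))
  have hinner : ∀ v ∈ Set.Ioi (0 : ℝ), ∫ τ in Set.Ioi (0 : ℝ), f v τ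
      = L ^ (-(s + α)) * Real.Gamma (s + α) *
        (v ^ (1 - α - 1) * (1 + v) ^ (-(1 - α + (D + 1 - s)))) := by
    intro v hv
    have hv : 0 < v := hv
    have h1v : 0 < 1 + v := by linarith
    simp only [f]
    rw [integral_const_mul, Real.integral_rpow_mul_exp_neg_mul_Ioi hp (by positivity), one_div,
      Real.inv_rpow (by positivity), Real.mul_rpow hL.le (by positivity),
      Real.div_rpow hv.le h1v.le, Real.rpow_neg hL.le,
      show 1 - α - 1 = s - (s + α) by ring,
      show -(1 - α + (D + 1 - s)) = (-D - 2) + (s + α) by ring, Real.rpow_add h1v (-D - 2),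
      Real.rpow_sub hv]
    field_simp
  have hbeta := integrableOn_rpow_mul_one_add_rpow ha hb
  have hfint : Integrable (Function.uncurry f)
      ((volume.restrict (Set.Ioi 0)).prod (volume.restrict (Set.Ioi 0))) := by
    rw [integrable_prod_iff (Measurable.aestronglyMeasurable (by unfold Function.uncurry; fun_prop))]
    refine ⟨(ae_restrict_iff' measurableSet_Ioi).2 (.of_forall fun v hv => ?_), ?_⟩
    · have hv : 0 < v := hv
      simp only [Function.uncurry, f]
      exact (integrableOn_rpow_mul_exp_neg_mul_Ioi hp (by positivity)).const_mul _
    · refine IntegrableOn.congr_fun (hbeta.const_mul (L ^ (-(s + α)) * Real.Gamma (s + α)))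
        (fun v hv => ?_) measurableSet_Ioi
      rw [← hinner v hv]
      refine setIntegral_congr_fun measurableSet_Ioi fun τ hτ => ?_
      have hv : 0 < v := hv
      have hτ : 0 < τ := hτ
      exact (Real.norm_of_nonneg (by simp only [f]; positivity)).symm
  have hswap := integral_integral_swap hfint
  rw [setIntegral_congr_fun measurableSet_Ioi hinner, integral_const_mul,
    integral_rpow_mul_one_add_rpow ha hb] at hswap
  rw [show D + 2 - s - α = 1 - α + (D + 1 - s) by ring, hswap]
  refine setIntegral_congr_fun measurableSet_Ioi fun τ _ => ?_
  simp only [f, mixKernel]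
  rw [← integral_const_mul]
  congr 1 with v
  rw [show L * τ * (v / (1 + v)) = L * (v / (1 + v)) * τ by ring]
  ring

lemma measurable_jap {d : ℕ} : Measurable (jap : EuclideanSpace ℝ (Fin d) → ℝ) := by
  unfold jap
  fun_prop

lemma jap_sq {d : ℕ} (k : EuclideanSpace ℝ (Fin d)) : jap k ^ 2 = 1 + ‖k‖ ^ 2 :=
  Real.sq_sqrt (by positivity)

lemma one_le_jap {d : ℕ} (k : EuclideanSpace ℝ (Fin d)) : 1 ≤ jap k :=
  Real.one_le_sqrt.2 (by linarith [sq_nonneg ‖k‖])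

lemma half_one_add_norm_le_jap {d : ℕ} (k : EuclideanSpace ℝ (Fin d)) :
    (1 + ‖k‖) / 2 ≤ jap k :=
  Real.le_sqrt_of_sq_le (by nlinarith [sq_nonneg (1 - ‖k‖), norm_nonneg k])

lemma norm_le_jap {d : ℕ} (k : EuclideanSpace ℝ (Fin d)) : ‖k‖ ≤ jap k :=
  Real.le_sqrt_of_sq_le (by linarith)

lemma abs_mixed_quotient_le {d : ℕ} (i j : Fin d) (k : EuclideanSpace ℝ (Fin d)) :
    |k i * k j ^ 2 / ‖k‖ ^ 2| ≤ ‖k‖ := by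
  have hi : |k i| ≤ ‖k‖ := PiLp.norm_apply_le k i
  have hj : |k j| ≤ ‖k‖ := PiLp.norm_apply_le k j
  rw [abs_div, abs_mul, abs_pow, abs_pow, abs_norm]
  refine div_le_of_le_mul₀ (by positivity) (by positivity) ?_
  gcongr

/-- The mixed integrand is absolutely integrable. -/
lemma integrable_mixed {d : ℕ} {s α : ℝ} (hs0 : 0 < s) (hsd : s < (d : ℝ) / 2)
    (hsα : 1 < s + α) (i j : Fin d) (p : EuclideanSpace ℝ (Fin d)) :
    Integrable fun k : EuclideanSpace ℝ (Fin d) =>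
      jap k ^ (-(d : ℝ) - 2 * α) * ‖p - k‖ ^ (-(2 * s)) * (k i * k j ^ 2 / ‖k‖ ^ 2) := by
  have hfin : Module.finrank ℝ (EuclideanSpace ℝ (Fin d)) = d := by simp
  have hd1 : 1 ≤ d := by
    have h : (0 : ℝ) < d := by linarith
    exact_mod_cast h
  have hball : Integrable ((Metric.ball (0 : EuclideanSpace ℝ (Fin d)) 1).indicator
      fun y => ‖y‖ ^ (-(2 * s))) := by
    rw [integrable_indicator_iff Metric.isOpen_ball.measurableSet]
    refine integrableOn_ball_of_norm_le_rpow (C := 1) (α := 2 * s) (by rw [hfin]; exact hd1)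
      (by rw [hfin]; linarith) (.of_forall fun y => ?_)
      (Measurable.aestronglyMeasurable (by fun_prop))
    rw [Real.norm_of_nonneg (by positivity), one_mul]
  have hball' := hball.comp_sub_right p
  have htail := (integrable_one_add_norm (E := EuclideanSpace ℝ (Fin d)) (μ := volume)
    (r := d + 2 * α + 2 * s - 1) (by rw [hfin]; linarith)).const_mul
      (2 ^ (d + 2 * α - 1) * (2 + ‖p‖) ^ (2 * s))
  have hm : Measurable fun k : EuclideanSpace ℝ (Fin d) =>
      jap k ^ (-(d : ℝ) - 2 * α) * ‖p - k‖ ^ (-(2 * s)) * (k i * k j ^ 2 / ‖k‖ ^ 2) := by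
    have := measurable_jap (d := d)
    fun_prop
  refine (hball'.add htail).mono' hm.aestronglyMeasurable (.of_forall fun k => ?_)
  have hj1 := one_le_jap k
  have hj0 : 0 < jap k := by linarith
  have hpk : 0 ≤ ‖p - k‖ ^ (-(2 * s)) := by positivity
  have hbound : ‖jap k ^ (-(d : ℝ) - 2 * α) * ‖p - k‖ ^ (-(2 * s)) * (k i * k j ^ 2 / ‖k‖ ^ 2)‖
      ≤ jap k ^ (-((d : ℝ) + 2 * α - 1)) * ‖p - k‖ ^ (-(2 * s)) := by
    rw [norm_mul, Real.norm_of_nonneg (by positivity), Real.norm_eq_abs]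
    calc _ ≤ jap k ^ (-(d : ℝ) - 2 * α) * ‖p - k‖ ^ (-(2 * s)) * jap k := by
          gcongr
          exact (abs_mixed_quotient_le i j k).trans (norm_le_jap k)
      _ = _ := by
          rw [show -((d : ℝ) + 2 * α - 1) = (-(d : ℝ) - 2 * α) + 1 by ring,
            Real.rpow_add_one hj0.ne']
          ring
  refine hbound.trans ?_
  simp only [Pi.add_apply]
  by_cases h : ‖p - k‖ < 1
  · have hmem : k - p ∈ Metric.ball (0 : EuclideanSpace ℝ (Fin d)) 1 := by
      rwa [mem_ball_zero_iff, norm_sub_rev]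
    rw [Set.indicator_of_mem hmem, norm_sub_rev k p]
    refine le_add_of_le_of_nonneg ?_ (by positivity)
    exact mul_le_of_le_one_left hpk (Real.rpow_le_one_of_one_le_of_nonpos hj1 (by linarith))
  · have hmem : k - p ∉ Metric.ball (0 : EuclideanSpace ℝ (Fin d)) 1 := by
      rwa [mem_ball_zero_iff, norm_sub_rev]
    rw [Set.indicator_of_notMem hmem, zero_add]
    push Not at h
    have hk0 : 0 < 1 + ‖k‖ := by positivity
    have hp0 : 0 < 2 + ‖p‖ := by positivity
    have h1 : jap k ^ (-((d : ℝ) + 2 * α - 1))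
        ≤ 2 ^ ((d : ℝ) + 2 * α - 1) * (1 + ‖k‖) ^ (-((d : ℝ) + 2 * α - 1)) := by
      calc _ ≤ ((1 + ‖k‖) / 2) ^ (-((d : ℝ) + 2 * α - 1)) :=
            Real.rpow_le_rpow_of_nonpos (by positivity) (half_one_add_norm_le_jap k) (by linarith)
        _ = _ := by
            rw [Real.div_rpow hk0.le two_pos.le, Real.rpow_neg two_pos.le, div_inv_eq_mul, mul_comm]
    have h2 : ‖p - k‖ ^ (-(2 * s)) ≤ (2 + ‖p‖) ^ (2 * s) * (1 + ‖k‖) ^ (-(2 * s)) := by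
      have h3 : (1 + ‖k‖) / (2 + ‖p‖) ≤ ‖p - k‖ := by
        rw [div_le_iff₀ hp0]
        have : ‖k‖ ≤ ‖p‖ + ‖p - k‖ := by
          rw [norm_sub_rev]
          exact norm_le_insert' k p
        nlinarith [norm_nonneg p]
      calc _ ≤ ((1 + ‖k‖) / (2 + ‖p‖)) ^ (-(2 * s)) :=
            Real.rpow_le_rpow_of_nonpos (by positivity) h3 (by linarith)
        _ = _ := by
            rw [Real.div_rpow hk0.le hp0.le, Real.rpow_neg hp0.le, div_inv_eq_mul, mul_comm]
    calc _ ≤ _ := mul_le_mul h1 h2 hpk (by positivity)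
      _ = _ := by
        rw [show -((d : ℝ) + 2 * α + 2 * s - 1) = -((d : ℝ) + 2 * α - 1) + -(2 * s) by ring,
          Real.rpow_add hk0]
        ring

/-- Subordination of the mixed integral: both radial factors are written as Laplace transforms
and the resulting Gaussian integrals are evaluated. -/
lemma mixed_subordination {d : ℕ} {s α l : ℝ} (hs0 : 0 < s) (hsd : s < (d : ℝ) / 2) (hα0 : 0 < α)
    (hsα : 1 < s + α) {i j : Fin d} (hij : i ≠ j) (hl : 0 < l) :
    IntegrableOn (fun τ => lowerGamma ((d : ℝ) / 2 + α) τ *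
        (τ ^ (s - (d : ℝ) / 2 - 1) * mixKernel s ((d : ℝ) / 2) (l ^ 2 * τ))) (Set.Ioi 0) ∧
    Real.Gamma s * Real.Gamma ((d : ℝ) / 2 + α) *
        ∫ k : EuclideanSpace ℝ (Fin d), jap k ^ (-(d : ℝ) - 2 * α) *
          ‖l • EuclideanSpace.single i (1 : ℝ) - k‖ ^ (-(2 * s)) * (k i * k j ^ 2 / ‖k‖ ^ 2)
      = l * (Real.pi ^ ((d : ℝ) / 2) / 2) *
        ∫ τ in Set.Ioi 0, lowerGamma ((d : ℝ) / 2 + α) τ *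
          (τ ^ (s - (d : ℝ) / 2 - 1) * mixKernel s ((d : ℝ) / 2) (l ^ 2 * τ)) := by
  set D : ℝ := (d : ℝ) / 2 with hD
  set β : ℝ := D + α with hβd
  set p : EuclideanSpace ℝ (Fin d) := l • EuclideanSpace.single i (1 : ℝ) with hp
  have hβ : 0 < β := by linarith
  have hGs := Real.Gamma_pos_of_pos hs0
  have hGβ := Real.Gamma_pos_of_pos hβ
  have hfin : Module.finrank ℝ (EuclideanSpace ℝ (Fin d)) = d := by simp
  have : Nontrivial (EuclideanSpace ℝ (Fin d)) := by
    apply Module.nontrivial_of_finrank_pos (R := ℝ)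
    rw [hfin]
    have h : (0 : ℝ) < d := by linarith
    exact_mod_cast h
  let f : EuclideanSpace ℝ (Fin d) → ℝ := fun k =>
    jap k ^ (-(d : ℝ) - 2 * α) * ‖p - k‖ ^ (-(2 * s)) * (k i * k j ^ 2 / ‖k‖ ^ 2)
  have hf : Integrable f := integrable_mixed hs0 hsd hsα i j p
  let A : EuclideanSpace ℝ (Fin d) → ℝ → ℝ := fun k t =>
    t ^ (s - 1) * Real.exp (-(‖p - k‖ ^ 2 * t))
  let B : EuclideanSpace ℝ (Fin d) → ℝ → ℝ := fun k τ =>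
    lowerGamma β τ * Real.exp (-(‖k‖ ^ 2 * τ))
  let F : EuclideanSpace ℝ (Fin d) → ℝ × ℝ → ℝ := fun k z =>
    (k i * k j ^ 2) * (A k z.1 * B k z.2)
  let μ : Measure ℝ := volume.restrict (Set.Ioi 0)
  have hA0 : ∀ k, ∀ t ∈ Set.Ioi (0 : ℝ), 0 ≤ A k t := fun k t ht =>
    mul_nonneg (Real.rpow_nonneg (le_of_lt ht) _) (Real.exp_pos _).le
  have hB0 : ∀ k, ∀ τ ∈ Set.Ioi (0 : ℝ), 0 ≤ B k τ := fun k τ hτ =>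
    mul_nonneg (lowerGamma_nonneg β (le_of_lt hτ)) (Real.exp_pos _).le
  have hae : ∀ᵐ k : EuclideanSpace ℝ (Fin d), 0 < ‖k‖ ^ 2 ∧ 0 < ‖p - k‖ ^ 2 := by
    filter_upwards [Measure.ae_ne volume (0 : EuclideanSpace ℝ (Fin d)), Measure.ae_ne volume p]
      with k h0 h1
    exact ⟨pow_pos (norm_pos_iff.2 h0) 2, pow_pos (norm_pos_iff.2 (sub_ne_zero.2 h1.symm)) 2⟩
  have hval : ∀ k : EuclideanSpace ℝ (Fin d), 0 < ‖k‖ ^ 2 → 0 < ‖p - k‖ ^ 2 →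
      (k i * k j ^ 2) * ((∫ t, A k t ∂μ) * ∫ τ, B k τ ∂μ)
        = Real.Gamma s * Real.Gamma β * f k := by
    intro k h0 h1
    simp only [A, B, f, μ]
    have e1 : (1 / ‖p - k‖ ^ 2) ^ s = ‖p - k‖ ^ (-(2 * s)) := by
      rw [one_div, Real.inv_rpow h1.le, Real.rpow_neg (norm_nonneg _), Real.rpow_mul (norm_nonneg _),
        Real.rpow_two]
    have e2 : (1 + ‖k‖ ^ 2) ^ (-β) = jap k ^ (-(d : ℝ) - 2 * α) := by
      rw [← jap_sq, ← Real.rpow_two, ← Real.rpow_mul (zero_le_one.trans (one_le_jap k)), hβd, hD]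
      ring_nf
    rw [Real.integral_rpow_mul_exp_neg_mul_Ioi hs0 h1, integral_lowerGamma_mul_exp hβ h0, e1, e2]
    ring
  have hmeas : Measurable (Function.uncurry F) := by
    have := (continuous_lowerGamma hβ).measurable
    simp only [F, A, B, Function.uncurry_def]
    fun_prop
  have hFint : Integrable (Function.uncurry F) (volume.prod (μ.prod μ)) := by
    rw [integrable_prod_iff hmeas.aestronglyMeasurable]
    constructor
    · filter_upwards [hae] with k hk
      exact (Integrable.mul_prod (integrableOn_rpow_mul_exp_neg_mul_Ioi hs0 hk.2)
        (integrableOn_lowerGamma_mul_exp hβ hk.1)).const_mul (k i * k j ^ 2)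
    · refine ((hf.norm.const_mul (Real.Gamma s * Real.Gamma β)).congr ?_)
      filter_upwards [hae] with k hk
      have h1 : ∫ t, ‖A k t‖ ∂μ = ∫ t, A k t ∂μ :=
        setIntegral_congr_fun measurableSet_Ioi fun t ht => Real.norm_of_nonneg (hA0 k t ht)
      have h2 : ∫ τ, ‖B k τ‖ ∂μ = ∫ τ, B k τ ∂μ :=
        setIntegral_congr_fun measurableSet_Ioi fun τ hτ => Real.norm_of_nonneg (hB0 k τ hτ)
      have h3 : 0 ≤ ∫ t, A k t ∂μ := setIntegral_nonneg measurableSet_Ioi (hA0 k)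
      have h4 : 0 ≤ ∫ τ, B k τ ∂μ := setIntegral_nonneg measurableSet_Ioi (hB0 k)
      simp only [Function.uncurry, F, norm_mul (k i * k j ^ 2)]
      simp only [norm_mul (A k _)]
      rw [integral_const_mul, integral_prod_mul (fun t => ‖A k t‖) (fun τ => ‖B k τ‖), h1, h2,
        ← Real.norm_of_nonneg (mul_nonneg h3 h4), ← norm_mul, hval k hk.1 hk.2, norm_mul _ (f k),
        Real.norm_of_nonneg (mul_pos hGs hGβ).le]
  let K : ℝ × ℝ → ℝ := fun z => l * (Real.pi ^ D / 2) * (lowerGamma β z.2 *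
    (z.1 ^ s * (z.1 + z.2) ^ (-D - 2) * Real.exp (-(l ^ 2 * (z.1 * z.2 / (z.1 + z.2))))))
  have hK : ∀ᵐ z ∂(μ.prod μ), ∫ k, F k z = K z := by
    rw [Measure.prod_restrict]
    refine (ae_restrict_iff' (measurableSet_Ioi.prod measurableSet_Ioi)).2 (.of_forall fun z hz => ?_)
    obtain ⟨ht, hτ⟩ := hz
    have ht : 0 < z.1 := ht
    have hτ : 0 < z.2 := hτ
    have e : ∀ k, F k z = (z.1 ^ (s - 1) * lowerGamma β z.2) * ((k i * k j ^ 2) *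
        Real.exp (-z.2 * ‖k‖ ^ 2 - z.1 * ‖p - k‖ ^ 2)) := by
      intro k
      simp only [F, A, B]
      rw [show -z.2 * ‖k‖ ^ 2 - z.1 * ‖p - k‖ ^ 2 = -(‖p - k‖ ^ 2 * z.1) + -(‖k‖ ^ 2 * z.2) by ring,
        Real.exp_add]
      ring
    simp_rw [e]
    rw [integral_const_mul, hp, integral_mixed_gaussian hij ht hτ, ← hD]
    simp only [K]
    rw [Real.rpow_sub_one ht.ne']
    field_simp
  have hKint : Integrable K (μ.prod μ) := hFint.integral_prod_right.congr hK
  have hin : ∀ τ ∈ Set.Ioi (0 : ℝ), ∫ t, K (t, τ) ∂μ = l * (Real.pi ^ D / 2) *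
      (lowerGamma β τ * (τ ^ (s - D - 1) * mixKernel s D (l ^ 2 * τ))) := by
    intro τ hτ
    have hτ : 0 < τ := hτ
    simp only [K]
    rw [integral_const_mul, integral_const_mul]
    congr 2
    simp only [μ, mixKernel]
    have h := integral_comp_mul_left_Ioi (fun t => t ^ s * (t + τ) ^ (-D - 2) *
      Real.exp (-(l ^ 2 * (t * τ / (t + τ))))) 0 hτ
    rw [mul_zero, smul_eq_mul, eq_inv_mul_iff_mul_eq₀ hτ.ne'] at h
    rw [← h, ← integral_const_mul, ← integral_const_mul]
    refine setIntegral_congr_fun measurableSet_Ioi fun v hv => ?_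
    have hv : 0 < v := hv
    have h1v : 0 < 1 + v := by linarith
    have e1 : τ * v + τ = τ * (1 + v) := by ring
    have e2 : τ * v * τ / (τ * (1 + v)) = τ * (v / (1 + v)) := by field_simp
    have e3 : τ ^ (s - D - 1) = τ * (τ ^ s * τ ^ (-D - 2)) := by
      rw [← Real.rpow_add hτ, mul_comm, ← Real.rpow_add_one hτ.ne']
      ring_nf
    simp only [e1, e2, e3]
    rw [Real.mul_rpow hτ.le hv.le, Real.mul_rpow hτ.le h1v.le, mul_assoc (l ^ 2)]
    ring
  have hc : l * (Real.pi ^ D / 2) ≠ 0 := by positivity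
  refine ⟨?_, ?_⟩
  · have h : IntegrableOn _ (Set.Ioi (0 : ℝ)) := hKint.integral_prod_right
    have h' := h.congr_fun hin measurableSet_Ioi
    exact (integrable_const_mul_iff hc.isUnit _).1 h'
  · calc Real.Gamma s * Real.Gamma β * ∫ k, f k
        = ∫ k, ∫ z, F k z ∂(μ.prod μ) := by
          rw [← integral_const_mul]
          refine integral_congr_ae ?_
          filter_upwards [hae] with k hk
          simp only [F]
          rw [integral_const_mul, integral_prod_mul, hval k hk.1 hk.2]
      _ = ∫ z, K z ∂(μ.prod μ) := by
          rw [integral_integral_swap hFint]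
          exact integral_congr_ae hK
      _ = ∫ τ, ∫ t, K (t, τ) ∂μ ∂μ := integral_prod_symm K hKint
      _ = _ := by
          rw [← integral_const_mul]
          exact setIntegral_congr_fun measurableSet_Ioi hin

lemma two_mul_Cconst {d : ℕ} {s α : ℝ} (hα0 : 0 < α) (hsα : 1 < s + α) :
    2 * α * (s + α - 1) * Cconst d s α = Real.pi ^ ((d : ℝ) / 2) / 2 / Real.Gamma s /
      Real.Gamma ((d : ℝ) / 2 + α) / ((d : ℝ) / 2 + α) * (Real.Gamma (s + α) *
        (Real.Gamma (1 - α) * Real.Gamma ((d : ℝ) / 2 + 1 - s) /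
          Real.Gamma ((d : ℝ) / 2 + 2 - s - α))) := by
  have hβ : 0 < (d : ℝ) / 2 + α := by positivity
  have h1 : Real.Gamma (s + α) = (s + α - 1) * Real.Gamma (s + α - 1) := by
    rw [← Real.Gamma_add_one (by linarith), sub_add_cancel]
  have h2 : Real.Gamma (1 - α) = -α * Real.Gamma (-α) := by
    rw [← Real.Gamma_add_one (by linarith), neg_add_eq_sub]
  have h3 : Real.Gamma (((d : ℝ) + 2 + 2 * α) / 2)
      = ((d : ℝ) / 2 + α) * Real.Gamma ((d : ℝ) / 2 + α) := by
    rw [← Real.Gamma_add_one hβ.ne']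
    ring_nf
  rw [Cconst, h1, h2, h3, show ((d : ℝ) - 2 * s + 2) / 2 = (d : ℝ) / 2 + 1 - s by ring,
    show ((d : ℝ) + 4 - 2 * s - 2 * α) / 2 = (d : ℝ) / 2 + 2 - s - α by ring]
  simp only [div_eq_mul_inv, mul_inv]
  ring

/-- Asymptotics of the mixed integral
`I_mix(λ) = λ ∫ ⟨k⟩^{−d−2α} |λe₁ − k|^{−2s} (k₁k₂²/|k|²) dk`: there are `R ≥ 1`, `ρ ≥ 0` with
`|I_mix(λ) − 2α(s+α−1) C_{d,s,α} λ^{−2s+2−2α}| ≤ ρ λ^{−2s}` for all `λ ≥ R`. -/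
theorem stmt7 (d : ℕ) (hd : 2 ≤ d) (s α : ℝ) (hs0 : 0 < s) (hsd : s < (d : ℝ)/2)
    (hα0 : 0 < α) (hα1 : α < 1) (hsα : 1 < s + α) :
    ∃ R ρ : ℝ, 1 ≤ R ∧ 0 ≤ ρ ∧ ∀ lam : ℝ, R ≤ lam →
      |lam * (∫ k : EuclideanSpace ℝ (Fin d),
          jap k ^ (-(d : ℝ) - 2*α)
            * ‖lam • EuclideanSpace.single (⟨0, by omega⟩ : Fin d) (1:ℝ) - k‖ ^ (-(2*s))
            * (k (⟨0, by omega⟩ : Fin d) * (k (⟨1, by omega⟩ : Fin d))^2 / ‖k‖^2))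
          - 2*α*(s + α - 1) * Cconst d s α * lam ^ (-(2*s) + 2 - 2*α)|
        ≤ ρ * lam ^ (-(2*s)) := by
  have hij : (⟨0, by omega⟩ : Fin d) ≠ ⟨1, by omega⟩ := by simp
  rw [two_mul_Cconst hα0 hsα]
  set D : ℝ := (d : ℝ) / 2 with hD
  set β : ℝ := D + α with hβd
  have hβ : 0 < β := by linarith
  have hGs := Real.Gamma_pos_of_pos hs0
  have hGβ := Real.Gamma_pos_of_pos hβ
  obtain ⟨C, hC0, hC⟩ := exists_mixKernel_le hs0 hsd
  set c : ℝ := Real.pi ^ D / 2 / Real.Gamma s / Real.Gamma β with hc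
  have hc0 : 0 ≤ c := by positivity
  set Q : ℝ := Real.Gamma (s + α) *
    (Real.Gamma (1 - α) * Real.Gamma (D + 1 - s) / Real.Gamma (D + 2 - s - α)) with hQ
  have hQ0 : 0 < Q := by
    have := Real.Gamma_pos_of_pos (by linarith : 0 < s + α)
    have := Real.Gamma_pos_of_pos (by linarith : 0 < 1 - α)
    have := Real.Gamma_pos_of_pos (by linarith : 0 < D + 1 - s)
    have := Real.Gamma_pos_of_pos (by linarith : 0 < D + 2 - s - α)
    positivity
  have hEint := integrableOn_rpow_div_sub_lowerGamma (γ := D + 2) hβ (by linarith) (by linarith)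
  set E : ℝ := ∫ τ in Set.Ioi (0 : ℝ), (τ ^ β / β - lowerGamma β τ) * τ ^ (-(D + 2)) with hE
  have hE0 : 0 ≤ E := setIntegral_nonneg measurableSet_Ioi fun τ hτ =>
    mul_nonneg (sub_nonneg.2 (lowerGamma_le hβ (le_of_lt hτ))) (Real.rpow_nonneg (le_of_lt hτ) _)
  refine ⟨1, c * (C * E), le_rfl, by positivity, fun l hl => ?_⟩
  have hl0 : 0 < l := by linarith
  have hL : 0 < l ^ 2 := by positivity
  obtain ⟨hWint, hW⟩ := mixed_subordination hs0 hsd hα0 hsα hij hl0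
  rw [← hD, ← hβd] at hWint hW
  have hM := integral_rpow_mul_mixKernel hs0 hsd hα0 hα1 hL
  rw [mul_assoc, ← hQ] at hM
  have hMint : IntegrableOn (fun τ => τ ^ (s + α - 1) * mixKernel s D (l ^ 2 * τ))
      (Set.Ioi 0) := by
    apply Integrable.of_integral_ne_zero
    rw [hM]
    positivity
  let err : ℝ → ℝ := fun τ => (τ ^ β / β - lowerGamma β τ) *
    (τ ^ (s - D - 1) * mixKernel s D (l ^ 2 * τ))
  have herr : Set.EqOn err (fun τ => τ ^ (s + α - 1) * mixKernel s D (l ^ 2 * τ) / β -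
      lowerGamma β τ * (τ ^ (s - D - 1) * mixKernel s D (l ^ 2 * τ))) (Set.Ioi 0) := by
    intro τ hτ
    simp only [err]
    rw [show s + α - 1 = β + (s - D - 1) by rw [hβd]; ring, Real.rpow_add hτ β]
    ring
  have herr_eq : ∫ τ in Set.Ioi 0, err τ = (l ^ 2) ^ (-(s + α)) * Q / β -
      ∫ τ in Set.Ioi 0, lowerGamma β τ * (τ ^ (s - D - 1) * mixKernel s D (l ^ 2 * τ)) := by
    rw [setIntegral_congr_fun measurableSet_Ioi herr, integral_sub (hMint.div_const β) hWint,
      integral_div, hM]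
  have herr0 : ∀ τ ∈ Set.Ioi (0 : ℝ), 0 ≤ err τ := fun τ hτ =>
    mul_nonneg (sub_nonneg.2 (lowerGamma_le hβ (le_of_lt hτ)))
      (mul_nonneg (Real.rpow_nonneg (le_of_lt hτ) _) (mixKernel_nonneg _ _ _))
  have herr_le : ∫ τ in Set.Ioi 0, err τ ≤ C * (l ^ 2) ^ (-s - 1) * E := by
    rw [hE, ← integral_const_mul]
    refine integral_mono_of_nonneg ((ae_restrict_iff' measurableSet_Ioi).2 (.of_forall herr0))
      (hEint.const_mul _) ((ae_restrict_iff' measurableSet_Ioi).2 (.of_forall fun τ hτ => ?_))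
    have hτ : 0 < τ := hτ
    have h1 : 0 ≤ τ ^ β / β - lowerGamma β τ := sub_nonneg.2 (lowerGamma_le hβ hτ.le)
    calc err τ ≤ (τ ^ β / β - lowerGamma β τ) *
          (τ ^ (s - D - 1) * (C * (l ^ 2 * τ) ^ (-s - 1))) := by
          simp only [err]
          gcongr
          exact hC _ (by positivity)
      _ = _ := by
          beta_reduce
          rw [Real.mul_rpow hL.le hτ.le, show -(D + 2) = (s - D - 1) + (-s - 1) by ring,
            Real.rpow_add hτ (s - D - 1)]
          ring
  have hmain : l ^ (-(2 * s) + 2 - 2 * α) = l ^ 2 * (l ^ 2) ^ (-(s + α)) := by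
    rw [← Real.rpow_two, ← Real.rpow_mul hl0.le, ← Real.rpow_add hl0]
    ring_nf
  have hrem : l ^ (-(2 * s)) = l ^ 2 * (l ^ 2) ^ (-s - 1) := by
    rw [← Real.rpow_two, ← Real.rpow_mul hl0.le, ← Real.rpow_add hl0]
    ring_nf
  rw [eq_div_of_mul_eq (mul_pos hGs hGβ).ne' ((mul_comm _ _).trans hW), hmain, hrem]
  have hfinal : l * (l * (Real.pi ^ D / 2) * (∫ τ in Set.Ioi 0, lowerGamma β τ *
        (τ ^ (s - D - 1) * mixKernel s D (l ^ 2 * τ))) / (Real.Gamma s * Real.Gamma β)) -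
      c / β * Q * (l ^ 2 * (l ^ 2) ^ (-(s + α))) = -(c * l ^ 2 * ∫ τ in Set.Ioi 0, err τ) := by
    rw [herr_eq, hc]
    field_simp
    ring
  rw [hfinal, abs_neg, abs_of_nonneg
    (mul_nonneg (by positivity) (setIntegral_nonneg measurableSet_Ioi herr0))]
  calc _ ≤ c * l ^ 2 * (C * (l ^ 2) ^ (-s - 1) * E) := by gcongr
    _ = _ := by ring
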